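/- arXiv:1402.2520 — 2 statements merged into one kernel-verified Lean document; each statement's English description precedes it below -/
import Mathlib

section
/- Let n, m be positive integers. For every f ∈ C[0,1], one has |∫₀¹ f(x) dx - I_{n,m}(f)| ≤ 2·K(1/(24·m²·n), f; C⁰[0,1], C²[0,1]). -/
open Set Finset

noncomputable section

/-- The sup norm of `f` on `[a,b]`. -/
def supAbs (a b : ℝ) (f : ℝ → ℝ) : ℝ := sSup ((fun x => |f x|) '' Set.Icc a b)

/-- The composite Bernstein quadrature functional `I_{n,m}`. -/
def quadI (n m : ℕ) (f : ℝ → ℝ) : ℝ :=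
  (1 / ((m : ℝ) * ((n : ℝ) + 1))) * ∑ k ∈ Finset.Icc 1 m, ∑ i ∈ Finset.range (n + 1),
    f (((k : ℝ) * n - n + i) / ((m : ℝ) * n))

/-- The K-functional with respect to `(C⁰[0,1], C²[0,1])`. -/
def Kfunctional (δ : ℝ) (f : ℝ → ℝ) : ℝ :=
  sInf {v | ∃ g : ℝ → ℝ, ContDiffOn ℝ 2 g (Set.Icc 0 1) ∧
    v = supAbs 0 1 (fun x => f x - g x) +
      δ * supAbs 0 1 (iteratedDerivWithin 2 g (Set.Icc 0 1))}

/-- The upper Hermite–Hadamard inequality. -/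
theorem integral_le_trapezoid_of_convexOn {a b : ℝ} (hab : a ≤ b) {h : ℝ → ℝ}
    (hconv : ConvexOn ℝ (Set.Icc a b) h) (hcont : ContinuousOn h (Set.Icc a b)) :
    ∫ x in a..b, h x ≤ (b - a) * ((h a + h b) / 2) := by
  rcases hab.eq_or_lt with rfl | hlt
  · simp
  have hpos : 0 < b - a := sub_pos.mpr hlt
  have hchord : ∀ x ∈ Set.Icc a b, h x ≤ h a + (h b - h a) / (b - a) * (x - a) := by
    intro x hx
    have key := hconv.2 (Set.left_mem_Icc.mpr hab) (Set.right_mem_Icc.mpr hab)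
      (div_nonneg (sub_nonneg.mpr hx.2) hpos.le) (div_nonneg (sub_nonneg.mpr hx.1) hpos.le)
      (by field_simp; ring)
    simp only [smul_eq_mul] at key
    have hx' : (b - x) / (b - a) * a + (x - a) / (b - a) * b = x := by field_simp; ring
    rw [hx'] at key
    refine key.trans_eq ?_
    field_simp
    ring
  calc ∫ x in a..b, h x ≤ ∫ x in a..b, (h a + (h b - h a) / (b - a) * (x - a)) := by
        refine intervalIntegral.integral_mono_on hab ?_ ?_ hchord
        · exact hcont.intervalIntegrable_of_Icc hab
        · exact Continuous.intervalIntegrable (by fun_prop) _ _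
    _ = (b - a) * ((h a + h b) / 2) := by
        rw [intervalIntegral.integral_add (by simp)
          (Continuous.intervalIntegrable (by fun_prop) _ _),
          intervalIntegral.integral_const_mul, intervalIntegral.integral_sub (by simp) (by simp)]
        simp only [intervalIntegral.integral_const, integral_id, smul_eq_mul]
        field_simp
        ring

theorem sum_range_succ_cast (n : ℕ) :
    ∑ i ∈ Finset.range (n + 1), (i : ℝ) = n * (n + 1) / 2 := by
  induction n with
  | zero => simp
  | succ k ih => rw [Finset.sum_range_succ, ih]; push_cast; ring

theorem sum_range_succ_cast_sq (n : ℕ) :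
    ∑ i ∈ Finset.range (n + 1), (i : ℝ) ^ 2 = n * (n + 1) * (2 * n + 1) / 6 := by
  induction n with
  | zero => simp
  | succ k ih => rw [Finset.sum_range_succ, ih]; push_cast; ring

theorem equispaced_mem_Icc {a b : ℝ} (hab : a ≤ b) {n i : ℕ} (hi : i ≤ n) :
    a + i / n * (b - a) ∈ Set.Icc a b := by
  have h0 : (0 : ℝ) ≤ i / n := by positivity
  have h1 : (i : ℝ) / n ≤ 1 := div_le_one_of_le₀ (by exact_mod_cast hi) (by positivity)
  constructor <;> nlinarith

theorem integral_eq_sum_equispaced {a b : ℝ} (hab : a ≤ b) {n : ℕ} (hn : 0 < n) {h : ℝ → ℝ}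
    (hcont : ContinuousOn h (Set.Icc a b)) :
    ∫ x in a..b, h x = ∑ i ∈ Finset.range n,
      ∫ x in (a + i / n * (b - a))..(a + (i + 1 : ℕ) / n * (b - a)), h x := by
  have hn' : (n : ℝ) ≠ 0 := by positivity
  rw [intervalIntegral.sum_integral_adjacent_intervals
    (a := fun i : ℕ => a + i / n * (b - a))]
  · simp [hn']
  · intro i hi
    refine (hcont.mono ?_).intervalIntegrable
    exact Set.uIcc_subset_Icc (equispaced_mem_Icc hab hi.le) (equispaced_mem_Icc hab hi)

/-- A discrete version of the upper Hermite–Hadamard inequality. -/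
theorem sum_equispaced_le_of_convexOn {a b : ℝ} (hab : a ≤ b) {n : ℕ} (hn : 0 < n) {h : ℝ → ℝ}
    (hconv : ConvexOn ℝ (Set.Icc a b) h) :
    ∑ i ∈ Finset.range (n + 1), h (a + i / n * (b - a)) ≤ (n + 1) * ((h a + h b) / 2) := by
  have hn' : (n : ℝ) ≠ 0 := by positivity
  have hchord : ∀ i ∈ Finset.range (n + 1),
      h (a + i / n * (b - a)) ≤ h a + i * ((h b - h a) / n) := by
    intro i hi
    have hin : i ≤ n := Nat.lt_succ_iff.mp (Finset.mem_range.mp hi)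
    have h1 : (i : ℝ) / n ≤ 1 := div_le_one_of_le₀ (by exact_mod_cast hin) (by positivity)
    have key := hconv.2 (Set.left_mem_Icc.mpr hab) (Set.right_mem_Icc.mpr hab)
      (sub_nonneg.mpr h1) (by positivity : (0 : ℝ) ≤ i / n) (by ring)
    simp only [smul_eq_mul] at key
    have hx : (1 - (i : ℝ) / n) * a + i / n * b = a + i / n * (b - a) := by ring
    rw [hx] at key
    refine key.trans_eq ?_
    ring
  refine (Finset.sum_le_sum hchord).trans_eq ?_
  rw [Finset.sum_add_distrib, ← Finset.sum_mul, sum_range_succ_cast]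
  simp only [Finset.sum_const, Finset.card_range, nsmul_eq_mul, Nat.cast_add, Nat.cast_one]
  field_simp
  ring

theorem integral_le_average_of_convexOn {a b : ℝ} (hab : a ≤ b) {n : ℕ} (hn : 0 < n)
    {h : ℝ → ℝ} (hconv : ConvexOn ℝ (Set.Icc a b) h) (hcont : ContinuousOn h (Set.Icc a b)) :
    ∫ x in a..b, h x ≤
      (b - a) / (n + 1) * ∑ i ∈ Finset.range (n + 1), h (a + i / n * (b - a)) := by
  have hnpos : (0 : ℝ) < n := by exact_mod_cast hn
  have hdisc := sum_equispaced_le_of_convexOn hab hn hconv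
  set p : ℕ → ℝ := fun i => a + i / n * (b - a) with hp
  set S := ∑ i ∈ Finset.range (n + 1), h (p i) with hS
  have hp0 : p 0 = a := by simp [hp]
  have hpn : p n = b := by simp [hp, hnpos.ne']
  have hS1 : ∑ i ∈ Finset.range n, h (p i) = S - h b := by
    rw [hS, Finset.sum_range_succ, hpn]; ring
  have hS2 : ∑ i ∈ Finset.range n, h (p (i + 1)) = S - h a := by
    rw [hS, Finset.sum_range_succ', hp0]; ring
  have hint : ∫ x in a..b, h x ≤ (b - a) / n * (S - (h a + h b) / 2) := by
    rw [integral_eq_sum_equispaced hab hn hcont]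
    calc _ ≤ ∑ i ∈ Finset.range n, (b - a) / n * ((h (p i) + h (p (i + 1))) / 2) := by
          refine Finset.sum_le_sum fun i hi => ?_
          have hin := Finset.mem_range.mp hi
          have hsub : Set.Icc (p i) (p (i + 1)) ⊆ Set.Icc a b :=
            Set.Icc_subset_Icc (equispaced_mem_Icc hab hin.le).1 (equispaced_mem_Icc hab hin).2
          have hdiff : p (i + 1) - p i = (b - a) / n := by
            simp only [hp]; push_cast; ring
          have hle : p i ≤ p (i + 1) := by
            rw [← sub_nonneg, hdiff]
            exact div_nonneg (sub_nonneg.mpr hab) hnpos.le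
          rw [← hdiff]
          exact integral_le_trapezoid_of_convexOn hle
            (hconv.subset hsub (convex_Icc _ _)) (hcont.mono hsub)
      _ = _ := by
          rw [← Finset.mul_sum, ← Finset.sum_div, Finset.sum_add_distrib, hS1, hS2]
          ring
  refine hint.trans ?_
  have hid : (b - a) / (n + 1) * S - (b - a) / n * (S - (h a + h b) / 2) =
      (b - a) / (n * (n + 1)) * ((n + 1) * ((h a + h b) / 2) - S) := by
    field_simp
    ring
  have := mul_nonneg (div_nonneg (sub_nonneg.mpr hab) (by positivity : (0 : ℝ) ≤ n * (n + 1)))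
    (sub_nonneg.mpr hdisc)
  linarith

theorem quadI_eq_sum_range {n m : ℕ} (hn : 0 < n) (f : ℝ → ℝ) :
    quadI n m f = (1 / ((m : ℝ) * ((n : ℝ) + 1))) *
      ∑ k ∈ Finset.range m, ∑ i ∈ Finset.range (n + 1), f ((k + i / n) / m) := by
  have hn' : (n : ℝ) ≠ 0 := by positivity
  have hIcc : Finset.Icc 1 m = Finset.Ico 1 (m + 1) := by ext; simp
  unfold quadI
  rw [hIcc, Finset.sum_Ico_eq_sum_range]
  congr 1
  refine Finset.sum_congr rfl fun k _ => Finset.sum_congr rfl fun i _ => ?_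
  congr 1
  rcases eq_or_ne (m : ℝ) 0 with hm | hm
  · simp [hm]
  · push_cast
    field_simp
    ring

theorem integral_le_quadI_of_convexOn {n m : ℕ} (hn : 0 < n) (hm : 0 < m) {h : ℝ → ℝ}
    (hconv : ConvexOn ℝ (Set.Icc 0 1) h) (hcont : ContinuousOn h (Set.Icc 0 1)) :
    ∫ x in (0 : ℝ)..1, h x ≤ quadI n m h := by
  have hmpos : (0 : ℝ) < m := by exact_mod_cast hm
  rw [quadI_eq_sum_range hn, integral_eq_sum_equispaced zero_le_one hm hcont, Finset.mul_sum]
  refine Finset.sum_le_sum fun k hk => ?_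
  have hkm := Finset.mem_range.mp hk
  have hsub : Set.Icc (0 + (k : ℝ) / m * (1 - 0)) (0 + (k + 1 : ℕ) / m * (1 - 0)) ⊆
      Set.Icc (0 : ℝ) 1 :=
    Set.Icc_subset_Icc (equispaced_mem_Icc zero_le_one hkm.le).1
      (equispaced_mem_Icc zero_le_one hkm).2
  have hdiff : (0 + ((k + 1 : ℕ) : ℝ) / m * (1 - 0)) - (0 + (k : ℝ) / m * (1 - 0)) = 1 / m := by
    push_cast; ring
  have hle : (0 + (k : ℝ) / m * (1 - 0)) ≤ (0 + ((k + 1 : ℕ) : ℝ) / m * (1 - 0)) := by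
    rw [← sub_nonneg, hdiff]; positivity
  refine (integral_le_average_of_convexOn hle hn
    (hconv.subset hsub (convex_Icc _ _)) (hcont.mono hsub)).trans_eq ?_
  rw [hdiff, div_div]
  congr 1
  refine Finset.sum_congr rfl fun i _ => ?_
  congr 1
  ring

theorem quadI_add (n m : ℕ) (f g : ℝ → ℝ) :
    quadI n m (fun x => f x + g x) = quadI n m f + quadI n m g := by
  simp only [quadI, Finset.sum_add_distrib, mul_add]

theorem quadI_const_mul (n m : ℕ) (c : ℝ) (f : ℝ → ℝ) :
    quadI n m (fun x => c * f x) = c * quadI n m f := by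
  simp only [quadI, ← Finset.mul_sum]
  ring

theorem quadI_sq {n m : ℕ} (hn : 0 < n) (hm : 0 < m) :
    quadI n m (fun x => x ^ 2) = 1 / 3 + 1 / (6 * (m : ℝ) ^ 2 * n) := by
  have hn' : (n : ℝ) ≠ 0 := by positivity
  have hm' : (m : ℝ) ≠ 0 := by positivity
  obtain ⟨l, rfl⟩ : ∃ l, m = l + 1 := ⟨m - 1, by omega⟩
  have hexp : ∀ k : ℕ, ∑ i ∈ Finset.range (n + 1),
      (((k : ℝ) + i / n) / (l + 1 : ℕ)) ^ 2 =
      ((n + 1) * (k : ℝ) ^ 2 + (n + 1) * k + (n + 1) * (2 * n + 1) / (6 * n)) /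
        ((l + 1 : ℕ) : ℝ) ^ 2 := by
    intro k
    have hterm : ∀ i : ℕ, (((k : ℝ) + i / n) / (l + 1 : ℕ)) ^ 2 =
        ((k : ℝ) ^ 2 + i * (2 * k / n) + (i : ℝ) ^ 2 * (1 / (n : ℝ) ^ 2)) /
          ((l + 1 : ℕ) : ℝ) ^ 2 := by
      intro i
      field_simp
      ring
    simp only [hterm]
    rw [← Finset.sum_div, Finset.sum_add_distrib, Finset.sum_add_distrib, ← Finset.sum_mul,
      ← Finset.sum_mul, sum_range_succ_cast, sum_range_succ_cast_sq]
    simp only [Finset.sum_const, Finset.card_range, nsmul_eq_mul, Nat.cast_add, Nat.cast_one]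
    field_simp
  rw [quadI_eq_sum_range hn]
  simp only [hexp]
  rw [← Finset.sum_div, Finset.sum_add_distrib, Finset.sum_add_distrib, ← Finset.mul_sum,
    ← Finset.mul_sum, sum_range_succ_cast, sum_range_succ_cast_sq]
  simp only [Finset.sum_const, Finset.card_range, nsmul_eq_mul]
  push_cast at hm' ⊢
  field_simp
  ring

theorem abs_quadI_le {n m : ℕ} (hn : 0 < n) (hm : 0 < m) {f : ℝ → ℝ} {C : ℝ}
    (hC : ∀ x ∈ Set.Icc (0 : ℝ) 1, |f x| ≤ C) : |quadI n m f| ≤ C := by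
  have hmpos : (0 : ℝ) < m := by exact_mod_cast hm
  rw [quadI_eq_sum_range hn, abs_mul, abs_of_nonneg (by positivity)]
  have hsum : |∑ k ∈ Finset.range m, ∑ i ∈ Finset.range (n + 1), f (((k : ℝ) + i / n) / m)| ≤
      ∑ k ∈ Finset.range m, ∑ i ∈ Finset.range (n + 1), C := by
    refine (Finset.abs_sum_le_sum_abs _ _).trans (Finset.sum_le_sum fun k hk => ?_)
    refine (Finset.abs_sum_le_sum_abs _ _).trans (Finset.sum_le_sum fun i hi => hC _ ?_)
    have hk' : (k : ℝ) + 1 ≤ m := by exact_mod_cast Finset.mem_range.mp hk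
    have hi' : (i : ℝ) / n ≤ 1 := div_le_one_of_le₀
      (by exact_mod_cast Nat.lt_succ_iff.mp (Finset.mem_range.mp hi)) (by positivity)
    exact ⟨by positivity, div_le_one_of_le₀ (by linarith) hmpos.le⟩
  refine (mul_le_mul_of_nonneg_left hsum (by positivity)).trans_eq ?_
  simp only [Finset.sum_const, Finset.card_range, nsmul_eq_mul, Nat.cast_add, Nat.cast_one]
  field_simp

theorem abs_le_supAbs {a b : ℝ} {f : ℝ → ℝ} (hf : ContinuousOn f (Set.Icc a b)) {x : ℝ}
    (hx : x ∈ Set.Icc a b) : |f x| ≤ supAbs a b f :=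
  le_csSup (isCompact_Icc.image_of_continuousOn hf.abs).bddAbove ⟨x, hx, rfl⟩

theorem convexOn_const_mul_sq_add {M : ℝ} {g : ℝ → ℝ}
    (hg : ContDiffOn ℝ 2 g (Set.Icc 0 1))
    (hM : ∀ x ∈ Set.Icc (0 : ℝ) 1, -M ≤ iteratedDerivWithin 2 g (Set.Icc 0 1) x) :
    ConvexOn ℝ (Set.Icc 0 1) (fun x => M / 2 * x ^ 2 + g x) := by
  have hgi : ∀ x ∈ Set.Ioo (0 : ℝ) 1, ContDiffAt ℝ 2 g x := fun x hx =>
    hg.contDiffAt (Icc_mem_nhds hx.1 hx.2)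
  have hd1 : ∀ x ∈ Set.Ioo (0 : ℝ) 1,
      HasDerivAt (fun x => M / 2 * x ^ 2 + g x) (M * x + deriv g x) x := by
    intro x hx
    have h1 := ((hasDerivAt_pow 2 x).const_mul (M / 2)).add
      ((hgi x hx).differentiableAt (by norm_num)).hasDerivAt
    refine h1.congr_deriv ?_
    norm_num
    ring
  have hd2 : ∀ x ∈ Set.Ioo (0 : ℝ) 1,
      HasDerivAt (fun x => M * x + deriv g x)
        (M + iteratedDerivWithin 2 g (Set.Icc 0 1) x) x := by
    intro x hx
    have hdd : DifferentiableAt ℝ (deriv g) x := by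
      have h1 : ContDiffAt ℝ 1 (deriv g) x := (hgi x hx).derivWithin (by norm_num)
      exact h1.differentiableAt one_ne_zero
    have heq : iteratedDerivWithin 2 g (Set.Icc 0 1) x = deriv (deriv g) x := by
      rw [iteratedDerivWithin_eq_iteratedDeriv (uniqueDiffOn_Icc one_pos) (hgi x hx)
        (Set.Ioo_subset_Icc_self hx), iteratedDeriv_succ, iteratedDeriv_one]
    rw [heq]
    refine (((hasDerivAt_id x).const_mul M).add hdd.hasDerivAt).congr_deriv ?_
    ring
  refine convexOn_of_hasDerivWithinAt2_nonneg (convex_Icc 0 1)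
    (f' := fun x => M * x + deriv g x)
    (f'' := fun x => M + iteratedDerivWithin 2 g (Set.Icc 0 1) x) ?_ ?_ ?_ ?_
  · exact ContinuousOn.add (by fun_prop) hg.continuousOn
  · rw [interior_Icc]; exact fun x hx => (hd1 x hx).hasDerivWithinAt
  · rw [interior_Icc]; exact fun x hx => (hd2 x hx).hasDerivWithinAt
  · rw [interior_Icc]
    intro x hx
    linarith [hM x (Set.Ioo_subset_Icc_self hx)]

theorem integral_sub_quadI_le {n m : ℕ} (hn : 0 < n) (hm : 0 < m) {M : ℝ} {g : ℝ → ℝ}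
    (hg : ContDiffOn ℝ 2 g (Set.Icc 0 1))
    (hM : ∀ x ∈ Set.Icc (0 : ℝ) 1, -M ≤ iteratedDerivWithin 2 g (Set.Icc 0 1) x) :
    (∫ x in (0 : ℝ)..1, g x) - quadI n m g ≤ M / (12 * (m : ℝ) ^ 2 * n) := by
  have hconv := convexOn_const_mul_sq_add hg hM
  have hle := integral_le_quadI_of_convexOn hn hm hconv
    (ContinuousOn.add (by fun_prop) hg.continuousOn)
  rw [quadI_add, quadI_const_mul, quadI_sq hn hm, intervalIntegral.integral_add
    (Continuous.intervalIntegrable (by fun_prop) _ _)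
    (hg.continuousOn.intervalIntegrable_of_Icc zero_le_one),
    intervalIntegral.integral_const_mul, integral_pow] at hle
  have hid : M / 2 * (1 / (6 * (m : ℝ) ^ 2 * n)) = M / (12 * (m : ℝ) ^ 2 * n) := by
    field_simp
    ring
  norm_num at hle hid ⊢
  linarith

theorem abs_integral_sub_quadI_le {n m : ℕ} (hn : 0 < n) (hm : 0 < m) {M : ℝ} {g : ℝ → ℝ}
    (hg : ContDiffOn ℝ 2 g (Set.Icc 0 1))
    (hM : ∀ x ∈ Set.Icc (0 : ℝ) 1, |iteratedDerivWithin 2 g (Set.Icc 0 1) x| ≤ M) :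
    |(∫ x in (0 : ℝ)..1, g x) - quadI n m g| ≤ M / (12 * (m : ℝ) ^ 2 * n) := by
  have hpos := integral_sub_quadI_le hn hm hg fun x hx => (abs_le.mp (hM x hx)).1
  have hneg := integral_sub_quadI_le (g := fun x => -g x) hn hm (M := M) hg.neg fun x hx => by
    rw [iteratedDerivWithin_fun_neg]
    exact neg_le_neg (abs_le.mp (hM x hx)).2
  have hq : quadI n m (fun x => -g x) = -quadI n m g := by
    simpa using quadI_const_mul n m (-1) g
  rw [intervalIntegral.integral_neg, hq] at hneg
  exact abs_le.mpr ⟨by linarith, hpos⟩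

theorem quadrature_error_Kfunctional
    (n m : ℕ) (hn : 0 < n) (hm : 0 < m)
    (f : ℝ → ℝ) (hf : ContinuousOn f (Set.Icc 0 1)) :
    |(∫ x in (0 : ℝ)..1, f x) - quadI n m f| ≤
      2 * Kfunctional (1 / (24 * (m : ℝ) ^ 2 * (n : ℝ))) f := by
  rw [← div_le_iff₀' two_pos]
  refine le_csInf ⟨_, 0, contDiffOn_const, rfl⟩ ?_
  rintro _ ⟨g, hg, rfl⟩
  rw [div_le_iff₀' two_pos]
  have hfg : ContinuousOn (fun x => f x - g x) (Set.Icc 0 1) := hf.sub hg.continuousOn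
  have hbound := fun x hx => abs_le_supAbs hfg (x := x) hx
  have hsmooth := abs_integral_sub_quadI_le hn hm hg fun x hx => abs_le_supAbs
    (hg.continuousOn_iteratedDerivWithin le_rfl (uniqueDiffOn_Icc one_pos)) hx
  have hquad := abs_quadI_le hn hm hbound
  have hint : |∫ x in (0 : ℝ)..1, (f x - g x)| ≤ supAbs 0 1 (fun x => f x - g x) := by
    have := intervalIntegral.norm_integral_le_of_norm_le_const
      (a := 0) (b := 1) (f := fun x => f x - g x) (C := supAbs 0 1 fun x => f x - g x)
      fun x hx => hbound x (by
        rw [Set.uIoc_of_le zero_le_one] at hx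
        exact Set.Ioc_subset_Icc_self hx)
    simpa using this
  have hI : ∫ x in (0 : ℝ)..1, f x =
      (∫ x in (0 : ℝ)..1, (f x - g x)) + ∫ x in (0 : ℝ)..1, g x := by
    rw [intervalIntegral.integral_sub (hf.intervalIntegrable_of_Icc zero_le_one)
      (hg.continuousOn.intervalIntegrable_of_Icc zero_le_one)]
    ring
  have hQ : quadI n m f = quadI n m (fun x => f x - g x) + quadI n m g := by
    simp [← quadI_add]
  have hid : ∀ M : ℝ, 2 * (1 / (24 * (m : ℝ) ^ 2 * n) * M) = M / (12 * (m : ℝ) ^ 2 * n) := by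
    intro M
    field_simp
    ring
  rw [mul_add, hid, hI, hQ]
  rw [abs_le] at *
  constructor <;> linarith [hsmooth.1, hsmooth.2, hquad.1, hquad.2, hint.1, hint.2]
end
end

section
/- Let (B, ‖·‖_B) be a Banach space and let H : C[a,b] → B be a map (not necessarily linear or positive) such that there exist constants γ, α, β₀, β₁, β₂ ≥ 0, independent of f and g, with: (a) ‖H(f+g)‖_B ≤ γ(‖Hf‖_B + ‖Hg‖_B) for all f, g ∈ C[a,b]; (b) ‖Hf‖_B ≤ α‖f‖_∞ for all f ∈ C[a,b]; (c) ‖Hg‖_B ≤ β₀‖g‖_∞ + β₁‖g′‖_∞ + β₂‖g″‖_∞ for all g ∈ C²[a,b]. Then for every f ∈ C[a,b] and every 0 < h ≤ (b-a)/2, one has ‖Hf‖_B ≤ γ·{β₀‖f‖_∞ + (2β₁/h)·ω₁(f; h) + (3/4)·(α + β₀ + 2β₁/h + 2β₂/h²)·ω₂(f; h)}. -/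
open Set Finset

noncomputable section

/-- First order modulus of continuity of `f` on `[a,b]`. -/
def omega1 (a b : ℝ) (f : ℝ → ℝ) (t : ℝ) : ℝ :=
  sSup {v | ∃ x ∈ Set.Icc a b, ∃ y ∈ Set.Icc a b, |x - y| ≤ t ∧ v = |f x - f y|}

/-- Second order modulus of smoothness of `f` on `[a,b]`. -/
def omega2 (a b : ℝ) (f : ℝ → ℝ) (δ : ℝ) : ℝ :=
  sSup {v | ∃ x h : ℝ, x - h ∈ Set.Icc a b ∧ x + h ∈ Set.Icc a b ∧ |h| ≤ δ ∧
    v = |f (x - h) - 2 * f x + f (x + h)|}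

theorem exists_abs_le_of_continuousOn_Icc {a b : ℝ} {f : ℝ → ℝ}
    (hf : ContinuousOn f (Set.Icc a b)) : ∃ M, ∀ x ∈ Set.Icc a b, |f x| ≤ M := by
  simpa using isCompact_Icc.exists_bound_of_continuousOn hf

theorem supAbs_le {a b c : ℝ} {f : ℝ → ℝ} (hab : a ≤ b) (h : ∀ x ∈ Set.Icc a b, |f x| ≤ c) :
    supAbs a b f ≤ c := by
  refine csSup_le ⟨_, a, left_mem_Icc.2 hab, rfl⟩ ?_
  rintro _ ⟨y, hy, rfl⟩
  exact h y hy

theorem abs_sub_le_omega1 {a b t : ℝ} {f : ℝ → ℝ} (hf : ContinuousOn f (Set.Icc a b)) {x y : ℝ}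
    (hx : x ∈ Set.Icc a b) (hy : y ∈ Set.Icc a b) (hxy : |x - y| ≤ t) :
    |f x - f y| ≤ omega1 a b f t := by
  obtain ⟨M, hM⟩ := exists_abs_le_of_continuousOn_Icc hf
  refine le_csSup ⟨M + M, ?_⟩ ⟨x, hx, y, hy, hxy, rfl⟩
  rintro _ ⟨u, hu, v, hv, -, rfl⟩
  exact (abs_sub _ _).trans (add_le_add (hM u hu) (hM v hv))

theorem abs_second_difference_le_omega2 {a b δ : ℝ} {f : ℝ → ℝ}
    (hf : ContinuousOn f (Set.Icc a b)) {x t : ℝ} (hx : x - t ∈ Set.Icc a b)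
    (hx' : x + t ∈ Set.Icc a b) (ht : |t| ≤ δ) :
    |f (x - t) - 2 * f x + f (x + t)| ≤ omega2 a b f δ := by
  obtain ⟨M, hM⟩ := exists_abs_le_of_continuousOn_Icc hf
  refine le_csSup ⟨4 * M, ?_⟩ ⟨x, t, hx, hx', ht, rfl⟩
  rintro _ ⟨y, s, hy, hy', -, rfl⟩
  have h₁ := abs_le.1 (hM _ hy)
  have h₂ := abs_le.1 (hM _ hy')
  have h₃ := abs_le.1 (hM y ⟨by linarith [hy.1, hy'.1], by linarith [hy.2, hy'.2]⟩)
  exact abs_le.2 ⟨by linarith [h₁.1, h₂.1, h₃.2], by linarith [h₁.2, h₂.2, h₃.1]⟩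

/-- A continuous function whose second differences are at least `-ω` on `[c, d]` cannot exceed its
values on both sides of a point by more than `ω`. -/
theorem not_peak_of_second_difference {c d ω : ℝ} {g : ℝ → ℝ}
    (hg : ContinuousOn g (Set.Icc c d))
    (hω : ∀ x t, c ≤ x - t → x + t ≤ d → 0 ≤ t → -ω ≤ g (x - t) - 2 * g x + g (x + t))
    {x₀ x₁ x₂ : ℝ} (hx₀ : c ≤ x₀) (h₀₁ : x₀ ≤ x₁) (h₁₂ : x₁ ≤ x₂) (hx₂ : x₂ ≤ d)
    (h₀ : ω < g x₁ - g x₀) (h₂ : ω < g x₁ - g x₂) : False := by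
  obtain ⟨z, hz, hmax⟩ := isCompact_Icc.exists_isMaxOn ⟨x₁, h₀₁, h₁₂⟩
    (hg.mono (Set.Icc_subset_Icc hx₀ hx₂))
  have hz₁ : g x₁ ≤ g z := hmax ⟨h₀₁, h₁₂⟩
  obtain ⟨hz₀, hz₂⟩ := hz
  rcases le_total (z - x₀) (x₂ - z) with hle | hle
  · have h := hω z (z - x₀) (by linarith) (by linarith) (by linarith)
    have h' : g (z + (z - x₀)) ≤ g z := hmax ⟨by linarith, by linarith⟩
    rw [sub_sub_cancel] at h
    linarith
  · have h := hω z (x₂ - z) (by linarith) (by linarith) (by linarith)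
    have h' : g (z - (x₂ - z)) ≤ g z := hmax ⟨by linarith, by linarith⟩
    rw [add_sub_cancel] at h
    linarith

/-- A continuous function with second differences bounded by `ω` cannot both rise and fall by more
than `ω`. -/
theorem not_rise_and_fall_of_second_difference {c d ω : ℝ} {g : ℝ → ℝ}
    (hg : ContinuousOn g (Set.Icc c d))
    (hω : ∀ x t, c ≤ x - t → x + t ≤ d → 0 ≤ t → |g (x - t) - 2 * g x + g (x + t)| ≤ ω)
    {x y x' y' : ℝ} (hy : c ≤ y) (hyx : y ≤ x) (hx : x ≤ d) (hy' : c ≤ y') (hyx' : y' ≤ x')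
    (hx' : x' ≤ d) (hrise : ω < g x - g y) (hfall : ω < g y' - g x') : False := by
  have peak : ∀ x₀ x₁ x₂, c ≤ x₀ → x₀ ≤ x₁ → x₁ ≤ x₂ → x₂ ≤ d → ω < g x₁ - g x₀ →
      ω < g x₁ - g x₂ → False := fun x₀ x₁ x₂ h₁ h₂ h₃ h₄ =>
    not_peak_of_second_difference hg (fun x t h h' h'' => (abs_le.1 (hω x t h h' h'')).1)
      h₁ h₂ h₃ h₄
  have valley : ∀ x₀ x₁ x₂, c ≤ x₀ → x₀ ≤ x₁ → x₁ ≤ x₂ → x₂ ≤ d → ω < g x₀ - g x₁ →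
      ω < g x₂ - g x₁ → False := fun x₀ x₁ x₂ h₁ h₂ h₃ h₄ h₅ h₆ =>
    not_peak_of_second_difference (ω := ω) (g := fun x => -g x) hg.neg
      (fun x t h h' h'' => by linarith [(abs_le.1 (hω x t h h' h'')).2]) h₁ h₂ h₃ h₄
      (by linarith) (by linarith)
  have hne : (Set.Icc c d).Nonempty := ⟨x, by linarith, hx⟩
  obtain ⟨u, hu, hmax⟩ := isCompact_Icc.exists_isMaxOn hne hg
  obtain ⟨v, hv, hmin⟩ := isCompact_Icc.exists_isMinOn hne hg
  have hmax' : ∀ z, c ≤ z → z ≤ d → g z ≤ g u := fun z h h' => hmax ⟨h, h'⟩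
  have hmin' : ∀ z, c ≤ z → z ≤ d → g v ≤ g z := fun z h h' => hmin ⟨h, h'⟩
  have hux := hmax' x (by linarith) hx
  have huy := hmax' y' hy' (by linarith)
  have hvy := hmin' y hy (by linarith)
  have hvx := hmin' x' (by linarith) hx'
  obtain ⟨hu₁, hu₂⟩ := hu
  obtain ⟨hv₁, hv₂⟩ := hv
  rcases le_total v u with hvu | huv
  · rcases le_total u x' with h | h
    · exact peak v u x' hv₁ hvu h hx' (by linarith) (by linarith)
    · rcases le_total y' v with h' | h'
      · exact valley y' v u hy' h' hvu hu₂ (by linarith) (by linarith)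
      · exact peak v y' x' hv₁ h' hyx' hx' (by linarith) (by linarith)
  · rcases le_total v x with h | h
    · exact valley u v x hu₁ huv h hx (by linarith) (by linarith)
    · rcases le_total y u with h' | h'
      · exact peak y u v hy h' huv hv₂ (by linarith) (by linarith)
      · exact valley u y x hu₁ h' hyx hx (by linarith) (by linarith)

/-- Whitney's inequality for affine approximation with constant `1 / 2`. -/
theorem exists_affine_approx {c d ω : ℝ} (hcd : c < d) (hω₀ : 0 ≤ ω) {g : ℝ → ℝ}
    (hg : ContinuousOn g (Set.Icc c d))
    (hω : ∀ x t, c ≤ x - t → x + t ≤ d → 0 ≤ t → |g (x - t) - 2 * g x + g (x + t)| ≤ ω) :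
    ∃ p q : ℝ, ∀ x ∈ Set.Icc c d, |g x - (p * x + q)| ≤ ω / 2 := by
  have hsep : ∃ p : ℝ, ∀ x y, c ≤ y → y < x → x ≤ d →
      (g x - g y - ω) / (x - y) ≤ p ∧ p ≤ (g x - g y + ω) / (x - y) := by
    obtain ⟨p, hp, hp'⟩ := exists_between_of_forall_le
      (s := {r | ∃ x y, c ≤ y ∧ y < x ∧ x ≤ d ∧ r = (g x - g y - ω) / (x - y)})
      (t := {r | ∃ x y, c ≤ y ∧ y < x ∧ x ≤ d ∧ r = (g x - g y + ω) / (x - y)})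
      ⟨_, d, c, le_rfl, hcd, le_rfl, rfl⟩ ⟨_, d, c, le_rfl, hcd, le_rfl, rfl⟩ (by
        rintro _ ⟨x, y, hy, hyx, hx, rfl⟩ _ ⟨x', y', hy', hyx', hx', rfl⟩
        by_contra! hlt
        obtain ⟨p, hp₁, hp₂⟩ := exists_between hlt
        rw [div_lt_iff₀ (sub_pos.2 hyx')] at hp₁
        rw [lt_div_iff₀ (sub_pos.2 hyx)] at hp₂
        refine not_rise_and_fall_of_second_difference (ω := ω) (g := fun x => g x - p * x)
          (by fun_prop) (fun x t h h' h'' => ?_) hy hyx.le hx hy' hyx'.le hx'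
          (by linarith) (by linarith)
        convert hω x t h h' h'' using 2
        ring)
    exact ⟨p, fun x y hy hyx hx => ⟨hp ⟨x, y, hy, hyx, hx, rfl⟩, hp' ⟨x, y, hy, hyx, hx, rfl⟩⟩⟩
  obtain ⟨p, hp⟩ := hsep
  have hosc : ∀ x ∈ Set.Icc c d, ∀ y ∈ Set.Icc c d, g x - p * x - (g y - p * y) ≤ ω := by
    intro x hx y hy
    rcases lt_trichotomy y x with h | rfl | h
    · have := (hp x y hy.1 h hx.2).1
      rw [div_le_iff₀ (sub_pos.2 h)] at this
      linarith
    · linarith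
    · have := (hp y x hx.1 h hy.2).2
      rw [le_div_iff₀ (sub_pos.2 h)] at this
      linarith
  have hne : (Set.Icc c d).Nonempty := ⟨c, le_rfl, hcd.le⟩
  have hg' : ContinuousOn (fun x => g x - p * x) (Set.Icc c d) := by fun_prop
  obtain ⟨u, hu, hmax⟩ := isCompact_Icc.exists_isMaxOn hne hg'
  obtain ⟨v, hv, hmin⟩ := isCompact_Icc.exists_isMinOn hne hg'
  refine ⟨p, ((g u - p * u) + (g v - p * v)) / 2, fun x hx => ?_⟩
  have h₁ : g x - p * x ≤ g u - p * u := hmax hx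
  have h₂ : g v - p * v ≤ g x - p * x := hmin hx
  have h₃ := hosc u hu v hv
  exact abs_le.2 ⟨by linarith, by linarith⟩

/-- A function on `[0, 2h]` extends continuously to the left of `0` so that second differences
reaching beyond `0` are at most `3 / 2` times the bound for those inside `[0, 2h]`. -/
theorem exists_continuous_left_extension {h ω : ℝ} (hh : 0 < h) (hω₀ : 0 ≤ ω) {g : ℝ → ℝ}
    (hg : ContinuousOn g (Set.Icc 0 (2 * h)))
    (hω : ∀ x t, 0 ≤ x - t → x + t ≤ 2 * h → 0 ≤ t → |g (x - t) - 2 * g x + g (x + t)| ≤ ω) :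
    ∃ E : ℝ → ℝ, Continuous E ∧ E 0 = g 0 ∧ ∀ x t, 0 ≤ x → x ≤ t → t ≤ h →
      |E (x - t) - 2 * g x + g (x + t)| ≤ 3 / 2 * ω := by
  obtain ⟨p, q, hpq⟩ := exists_affine_approx (by linarith) hω₀ hg hω
  obtain ⟨e, he⟩ : ∃ e : ℝ → ℝ, ∀ x, e x = g x - (p * x + q) := ⟨_, fun _ => rfl⟩
  have heb : ∀ x, 0 ≤ x → x ≤ 2 * h → |e x| ≤ ω / 2 := fun x h₁ h₂ => he x ▸ hpq x ⟨h₁, h₂⟩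
  have hδ : ∃ δ > 0, ∀ x y, 0 ≤ x → x ≤ 2 * h → 0 ≤ y → y ≤ 2 * h → |x - y| < δ →
      |e x - e y| ≤ ω / 2 := by
    rcases hω₀.eq_or_lt with rfl | hpos
    · refine ⟨1, one_pos, fun x y hx hx' hy hy' _ => ?_⟩
      have h₁ := heb x hx hx'
      have h₂ := heb y hy hy'
      exact (abs_sub _ _).trans (by linarith)
    · have hec : ContinuousOn e (Set.Icc 0 (2 * h)) := by
        rw [funext he]
        fun_prop
      obtain ⟨δ, hδ, hed⟩ := Metric.uniformContinuousOn_iff.1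
        (isCompact_Icc.uniformContinuousOn_of_continuous hec) (ω / 2) (by linarith)
      exact ⟨δ, hδ, fun x y hx hx' hy hy' hxy => (hed x ⟨hx, hx'⟩ y ⟨hy, hy'⟩ hxy).le⟩
  obtain ⟨δ, hδ, hed⟩ := hδ
  refine ⟨fun s => p * s + q + max 0 (1 + s / δ) * e 0, by fun_prop, by simp [he],
    fun x t hx hxt hth => ?_⟩
  have hA := abs_le.1 (heb x hx (by linarith))
  have hB := abs_le.1 (heb (x + t) (by linarith) (by linarith))
  have hform : p * (x - t) + q + max 0 (1 + (x - t) / δ) * e 0 - 2 * g x + g (x + t) =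
      e (x + t) - 2 * e x + max 0 (1 + (x - t) / δ) * e 0 := by
    rw [he x, he (x + t)]
    ring
  simp only [hform]
  rcases le_or_gt δ (t - x) with hle | hlt
  · have : 1 + (x - t) / δ ≤ 0 := by
      have : (x - t) / δ ≤ -1 := by
        rw [div_le_iff₀ hδ]
        linarith
      linarith
    rw [max_eq_left this]
    exact abs_le.2 ⟨by linarith, by linarith⟩
  · have h0 : -1 < (x - t) / δ := by
      rw [lt_div_iff₀ hδ]
      linarith
    have h1 : (x - t) / δ ≤ 0 := div_nonpos_of_nonpos_of_nonneg (by linarith) hδ.le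
    rw [max_eq_right (by linarith)]
    set l := 1 + (x - t) / δ with hl
    have h₁ := abs_le.1 (hω x x (by linarith) (by linarith) hx)
    have h₂ := abs_le.1 (hed (x + t) (x + x) (by linarith) (by linarith) (by linarith)
      (by linarith) (by rw [abs_lt]; constructor <;> linarith))
    have hform' : g (x - x) - 2 * g x + g (x + x) = e 0 - 2 * e x + e (x + x) := by
      rw [he x, he (x + x), he 0, sub_self]
      ring
    rw [hform'] at h₁
    have hl0 : 0 ≤ l := by linarith
    have hl1 : 0 ≤ 1 - l := by linarith
    obtain ⟨hA₁, hA₂⟩ := hA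
    obtain ⟨hB₁, hB₂⟩ := hB
    obtain ⟨h₁₁, h₁₂⟩ := h₁
    obtain ⟨h₂₁, h₂₂⟩ := h₂
    rw [abs_le]
    constructor
    · have k₁ := mul_nonneg hl1
        (show 0 ≤ e (x + t) - 2 * e x + 3 / 2 * ω by linarith)
      have k₂ := mul_nonneg hl0
        (show 0 ≤ e (x + t) - 2 * e x + e 0 + 3 / 2 * ω by linarith)
      linarith
    · have k₁ := mul_nonneg hl1
        (show 0 ≤ 3 / 2 * ω - (e (x + t) - 2 * e x) by linarith)
      have k₂ := mul_nonneg hl0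
        (show 0 ≤ 3 / 2 * ω - (e (x + t) - 2 * e x + e 0) by linarith)
      linarith

/-- A continuous variant of Zhuk's extension. -/
theorem exists_continuous_extension {a b h : ℝ} {f : ℝ → ℝ}
    (hf : ContinuousOn f (Set.Icc a b)) (hh : 0 < h) (hh2 : h ≤ (b - a) / 2) :
    ∃ F : ℝ → ℝ, Continuous F ∧ (∀ x ∈ Set.Icc a b, F x = f x) ∧
      ∀ x ∈ Set.Icc a b, ∀ t, 0 ≤ t → t ≤ h →
        |F (x - t) - 2 * F x + F (x + t)| ≤ 3 / 2 * omega2 a b f h := by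
  have hω : ∀ x t, a ≤ x - t → x + t ≤ b → 0 ≤ t → t ≤ h →
      |f (x - t) - 2 * f x + f (x + t)| ≤ omega2 a b f h := fun x t h₁ h₂ h₃ h₄ =>
    abs_second_difference_le_omega2 hf ⟨h₁, by linarith⟩ ⟨by linarith, h₂⟩
      (by rwa [abs_of_nonneg h₃])
  have hω₀ : 0 ≤ omega2 a b f h :=
    (abs_nonneg _).trans (hω a 0 (by linarith) (by linarith) le_rfl hh.le)
  obtain ⟨L, hLc, hL0, hL⟩ := exists_continuous_left_extension (g := fun u => f (a + u)) hh hω₀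
    (hf.comp (by fun_prop) fun u hu => ⟨by linarith [hu.1], by linarith [hu.2]⟩)
    (fun x t h₁ h₂ h₃ => by
      have := hω (a + x) t (by linarith) (by linarith) h₃ (by linarith)
      rwa [add_sub_assoc, add_assoc] at this)
  obtain ⟨R, hRc, hR0, hR⟩ := exists_continuous_left_extension (g := fun u => f (b - u)) hh hω₀
    (hf.comp (by fun_prop) fun u hu => ⟨by linarith [hu.2], by linarith [hu.1]⟩)
    (fun x t h₁ h₂ h₃ => by
      have := hω (b - x) t (by linarith) (by linarith) h₃ (by linarith)
      rw [show b - x - t = b - (x + t) by ring, show b - x + t = b - (x - t) by ring] at this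
      convert this using 2
      ring)
  simp only [add_zero, sub_zero] at hL0 hR0
  obtain ⟨F, hF⟩ : ∃ F : ℝ → ℝ, ∀ x, F x = f (max a (min b x)) +
    (L (min (x - a) 0) - L 0) + (R (min (b - x) 0) - R 0) := ⟨_, fun _ => rfl⟩
  have hFm : ∀ x, a ≤ x → x ≤ b → F x = f x := fun x h₁ h₂ => by
    simp [hF, h₁, h₂]
  have hFl : ∀ x, x ≤ a → F x = L (x - a) := fun x hx => by
    rw [hF, min_eq_right (by linarith : x ≤ b), max_eq_left hx, min_eq_left (by linarith),
      min_eq_right (by linarith), hL0]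
    ring
  have hFr : ∀ x, b ≤ x → F x = R (b - x) := fun x hx => by
    rw [hF, min_eq_left hx, max_eq_right (by linarith), min_eq_right (by linarith),
      min_eq_left (by linarith), hR0]
    ring
  refine ⟨F, ?_, fun x hx => hFm x hx.1 hx.2, fun x hx t ht hth => ?_⟩
  · have hfc : Continuous fun x => f (max a (min b x)) :=
      hf.comp_continuous (by fun_prop) fun x =>
        ⟨le_max_left _ _, max_le (by linarith) (min_le_left _ _)⟩
    rw [funext hF]
    exact (hfc.add (by fun_prop)).add (by fun_prop)
  · obtain ⟨hxa, hxb⟩ := hx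
    rw [hFm x hxa hxb]
    rcases le_total (x - t) a with hl | hl
    · rw [hFl _ hl, hFm (x + t) (by linarith) (by linarith)]
      have := hL (x - a) t (by linarith) (by linarith) hth
      rwa [add_sub_cancel, show a + (x - a + t) = x + t by ring,
        show x - a - t = x - t - a by ring] at this
    · rcases le_total b (x + t) with hr | hr
      · rw [hFr _ hr, hFm (x - t) (by linarith) (by linarith)]
        have := hR (b - x) t (by linarith) (by linarith) hth
        rw [sub_sub_cancel, show b - (b - x + t) = x - t by ring,
          show b - x - t = b - (x + t) by ring] at this
        convert this using 2
        ring
      · rw [hFm _ hl (by linarith), hFm _ (by linarith) hr]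
        exact (hω x t hl hr ht hth).trans (by linarith)

theorem abs_le_mul_of_hasDerivAt {φ φ' : ℝ → ℝ} {C T : ℝ} (h0 : φ 0 = 0)
    (hφ : ∀ t, HasDerivAt φ (φ' t) t) (hC : ∀ t, 0 ≤ t → t ≤ T → |φ' t| ≤ C) :
    ∀ t, 0 ≤ t → t ≤ T → |φ t| ≤ C * t := by
  intro t ht htT
  refine image_norm_le_of_norm_deriv_right_le_deriv_boundary (a := 0) (b := T)
    (B := fun t => C * t) (B' := fun _ => C)
    (fun t _ => (hφ t).continuousAt.continuousWithinAt)
    (fun t _ => (hφ t).hasDerivWithinAt) (by simp [h0])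
    (fun t => by simpa using (hasDerivAt_id t).const_mul C)
    (fun t ht => hC t ht.1 ht.2.le) ⟨ht, htT⟩

theorem abs_le_mul_sq_of_hasDerivAt {φ φ' : ℝ → ℝ} {C T : ℝ} (h0 : φ 0 = 0)
    (hφ : ∀ t, HasDerivAt φ (φ' t) t) (hC : ∀ t, 0 ≤ t → t ≤ T → |φ' t| ≤ C * t) :
    ∀ t, 0 ≤ t → t ≤ T → |φ t| ≤ C / 2 * t ^ 2 := by
  intro t ht htT
  refine image_norm_le_of_norm_deriv_right_le_deriv_boundary (a := 0) (b := T)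
    (B := fun t => C / 2 * t ^ 2) (B' := fun t => C * t)
    (fun t _ => (hφ t).continuousAt.continuousWithinAt)
    (fun t _ => (hφ t).hasDerivWithinAt) (by simp [h0])
    (fun t => ?_)
    (fun t ht => hC t ht.1 ht.2.le) ⟨ht, htT⟩
  exact ((hasDerivAt_pow 2 t).const_mul (C / 2)).congr_deriv (by norm_num; ring)

/-- Smoothing by a second order Steklov mean of a continuous variant of Zhuk's extension. -/
theorem exists_smooth_approx {a b h : ℝ} {f : ℝ → ℝ}
    (hf : ContinuousOn f (Set.Icc a b)) (hh : 0 < h) (hh2 : h ≤ (b - a) / 2) :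
    ∃ g g' g'' : ℝ → ℝ, (∀ x, HasDerivAt g (g' x) x) ∧ (∀ x, HasDerivAt g' (g'' x) x) ∧
      Continuous g'' ∧ ∀ x ∈ Set.Icc a b,
        |g x - f x| ≤ 3 / 4 * omega2 a b f h ∧
        |g' x| ≤ (2 * omega1 a b f h + 3 / 2 * omega2 a b f h) / h ∧
        |g'' x| ≤ 3 / 2 * omega2 a b f h / h ^ 2 := by
  obtain ⟨F, hFc, hFf, hF⟩ := exists_continuous_extension hf hh hh2
  obtain ⟨F₁, hF₁⟩ : ∃ F₁ : ℝ → ℝ, ∀ x, HasDerivAt F₁ (F x) x :=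
    ⟨fun x => ∫ y in (0 : ℝ)..x, F y, fun x => hFc.integral_hasStrictDerivAt 0 x |>.hasDerivAt⟩
  have hF₁c : Continuous F₁ := continuous_iff_continuousAt.2 fun x => (hF₁ x).continuousAt
  obtain ⟨F₂, hF₂⟩ : ∃ F₂ : ℝ → ℝ, ∀ x, HasDerivAt F₂ (F₁ x) x :=
    ⟨fun x => ∫ y in (0 : ℝ)..x, F₁ y, fun x => hF₁c.integral_hasStrictDerivAt 0 x |>.hasDerivAt⟩
  have hdiff : ∀ {φ φ' : ℝ → ℝ}, (∀ x, HasDerivAt φ (φ' x) x) → ∀ x,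
      HasDerivAt (fun x => (φ (x - h) - 2 * φ x + φ (x + h)) / h ^ 2)
        ((φ' (x - h) - 2 * φ' x + φ' (x + h)) / h ^ 2) x := fun hφ x =>
    ((((hφ (x - h)).comp_sub_const x h).sub ((hφ x).const_mul 2)).add
      ((hφ (x + h)).comp_add_const x h)).div_const _
  have hright : ∀ {φ φ' : ℝ → ℝ}, (∀ x, HasDerivAt φ (φ' x) x) → ∀ x t,
      HasDerivAt (fun t => φ (x + t)) (φ' (x + t)) t := fun hφ x t =>
    (hφ (x + t)).comp_const_add x t
  have hleft : ∀ {φ φ' : ℝ → ℝ}, (∀ x, HasDerivAt φ (φ' x) x) → ∀ x t,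
      HasDerivAt (fun t => φ (x - t)) (-φ' (x - t)) t := fun hφ x t =>
    (hφ (x - t)).comp_const_sub x t
  refine ⟨_, _, fun x => (F (x - h) - 2 * F x + F (x + h)) / h ^ 2, hdiff hF₂, hdiff hF₁,
    by fun_prop, fun x hx => ⟨?_, ?_, ?_⟩⟩
  · have hd₁ : ∀ t, HasDerivAt (fun t => F₁ (x + t) - F₁ (x - t) - 2 * F x * t)
        (F (x - t) - 2 * F x + F (x + t)) t := fun t =>
      (((hright hF₁ x t).sub (hleft hF₁ x t)).sub
        ((hasDerivAt_id t).const_mul (2 * F x))).congr_deriv (by ring)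
    have hd₂ : ∀ t, HasDerivAt (fun t => F₂ (x - t) - 2 * F₂ x + F₂ (x + t) - F x * t ^ 2)
        (F₁ (x + t) - F₁ (x - t) - 2 * F x * t) t := fun t =>
      ((((hleft hF₂ x t).sub_const (2 * F₂ x)).add (hright hF₂ x t)).sub
        ((hasDerivAt_pow 2 t).const_mul (F x))).congr_deriv (by norm_num; ring)
    have hb := abs_le_mul_sq_of_hasDerivAt (by simp; ring) hd₂
      (abs_le_mul_of_hasDerivAt (by simp) hd₁ (hF x hx)) h hh.le le_rfl
    rw [← hFf x hx, show (F₂ (x - h) - 2 * F₂ x + F₂ (x + h)) / h ^ 2 - F x =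
      (F₂ (x - h) - 2 * F₂ x + F₂ (x + h) - F x * h ^ 2) / h ^ 2 by field_simp, abs_div,
      abs_of_pos (pow_pos hh 2), div_le_iff₀ (pow_pos hh 2)]
    linarith
  · have hd : ∀ t, HasDerivAt (fun t => F₁ (x - t) - 2 * F₁ x + F₁ (x + t))
        (F (x + t) - F (x - t)) t := fun t =>
      (((hleft hF₁ x t).sub_const (2 * F₁ x)).add (hright hF₁ x t)).congr_deriv (by ring)
    have hb := abs_le_mul_of_hasDerivAt (C := 2 * omega1 a b f h + 3 / 2 * omega2 a b f h)
      (by simp; ring) hd (fun t ht hth => ?_) h hh.le le_rfl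
    · rw [abs_div, abs_of_pos (pow_pos hh 2), div_le_div_iff₀ (pow_pos hh 2) hh]
      calc _ ≤ ((2 * omega1 a b f h + 3 / 2 * omega2 a b f h) * h) * h := by gcongr
        _ = _ := by ring
    · have h₂ := abs_le.1 (hF x hx t ht hth)
      obtain ⟨hxa, hxb⟩ := hx
      rcases le_total (x + t) b with hr | hr
      · have hm : x + t ∈ Set.Icc a b := ⟨by linarith, hr⟩
        have h₁ := abs_le.1 (abs_sub_le_omega1 (t := h) hf hm ⟨hxa, hxb⟩
          (by rwa [add_sub_cancel_left, abs_of_nonneg ht]))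
        rw [← hFf _ hm, ← hFf x ⟨hxa, hxb⟩] at h₁
        exact abs_le.2 ⟨by linarith, by linarith⟩
      · have hm : x - t ∈ Set.Icc a b := ⟨by linarith, by linarith⟩
        have h₁ := abs_le.1 (abs_sub_le_omega1 (t := h) hf ⟨hxa, hxb⟩ hm
          (by rwa [sub_sub_cancel, abs_of_nonneg ht]))
        rw [← hFf _ hm, ← hFf x ⟨hxa, hxb⟩] at h₁
        exact abs_le.2 ⟨by linarith, by linarith⟩
  · rw [abs_div, abs_of_pos (pow_pos hh 2)]
    gcongr
    exact hF x hx h hh.le le_rfl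

theorem gonska_kovacheva
    {E : Type*} [NormedAddCommGroup E] [NormedSpace ℝ E] [CompleteSpace E]
    (a b : ℝ) (hab : a < b) (H : (ℝ → ℝ) → E)
    (γ α β₀ β₁ β₂ : ℝ) (hγ : 0 ≤ γ) (hα : 0 ≤ α) (hβ₀ : 0 ≤ β₀) (hβ₁ : 0 ≤ β₁) (hβ₂ : 0 ≤ β₂)
    (hsub : ∀ f g : ℝ → ℝ, ContinuousOn f (Set.Icc a b) → ContinuousOn g (Set.Icc a b) →
      ‖H (f + g)‖ ≤ γ * (‖H f‖ + ‖H g‖))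
    (hbdd : ∀ f : ℝ → ℝ, ContinuousOn f (Set.Icc a b) → ‖H f‖ ≤ α * supAbs a b f)
    (hsmooth : ∀ g : ℝ → ℝ, ContDiffOn ℝ 2 g (Set.Icc a b) →
      ‖H g‖ ≤ β₀ * supAbs a b g + β₁ * supAbs a b (derivWithin g (Set.Icc a b)) +
        β₂ * supAbs a b (iteratedDerivWithin 2 g (Set.Icc a b)))
    (f : ℝ → ℝ) (hf : ContinuousOn f (Set.Icc a b))
    (h : ℝ) (hh : 0 < h) (hh2 : h ≤ (b - a) / 2) :
    ‖H f‖ ≤ γ * (β₀ * supAbs a b f + 2 * β₁ / h * omega1 a b f h +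
      3 / 4 * (α + β₀ + 2 * β₁ / h + 2 * β₂ / h ^ 2) * omega2 a b f h) := by
  obtain ⟨g, g', g'', hg, hg', hg'', happ⟩ := exists_smooth_approx hf hh hh2
  have hu : UniqueDiffOn ℝ (Set.Icc a b) := uniqueDiffOn_Icc hab
  have hgd : deriv g = g' := funext fun x => (hg x).deriv
  have hgd' : deriv g' = g'' := funext fun x => (hg' x).deriv
  have hgC : ContDiff ℝ 2 g := by
    rw [show (2 : WithTop ℕ∞) = 1 + 1 by norm_num, contDiff_succ_iff_deriv, hgd,
      contDiff_one_iff_deriv, hgd']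
    exact ⟨fun x => (hg x).differentiableAt, by simp, fun x => (hg' x).differentiableAt, hg''⟩
  have hgc : ContinuousOn g (Set.Icc a b) := hgC.continuous.continuousOn
  have hd₁ : ∀ x ∈ Set.Icc a b, derivWithin g (Set.Icc a b) x = g' x := fun x hx =>
    (hg x).hasDerivWithinAt.derivWithin (hu x hx)
  have hd₂ : ∀ x ∈ Set.Icc a b, iteratedDerivWithin 2 g (Set.Icc a b) x = g'' x := fun x hx => by
    rw [iteratedDerivWithin_eq_iteratedDeriv hu hgC.contDiffAt hx, iteratedDeriv_succ,
      iteratedDeriv_one, hgd, hgd']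
  have hsum := hsub (f - g) g (hf.sub hgc) hgc
  rw [sub_add_cancel] at hsum
  have hfg : supAbs a b (f - g) ≤ 3 / 4 * omega2 a b f h := supAbs_le hab.le fun x hx => by
    rw [Pi.sub_apply, abs_sub_comm]
    exact (happ x hx).1
  have hg₀ : supAbs a b g ≤ supAbs a b f + 3 / 4 * omega2 a b f h := supAbs_le hab.le fun x hx => by
    have h₁ := abs_sub_abs_le_abs_sub (g x) (f x)
    linarith [(happ x hx).1, abs_le_supAbs hf hx]
  have hg₁ : supAbs a b (derivWithin g (Set.Icc a b)) ≤
      (2 * omega1 a b f h + 3 / 2 * omega2 a b f h) / h := supAbs_le hab.le fun x hx => by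
    rw [hd₁ x hx]
    exact (happ x hx).2.1
  have hg₂ : supAbs a b (iteratedDerivWithin 2 g (Set.Icc a b)) ≤
      3 / 2 * omega2 a b f h / h ^ 2 := supAbs_le hab.le fun x hx => by
    rw [hd₂ x hx]
    exact (happ x hx).2.2
  calc ‖H f‖ ≤ γ * (‖H (f - g)‖ + ‖H g‖) := hsum
    _ ≤ γ * (α * supAbs a b (f - g) + (β₀ * supAbs a b g +
        β₁ * supAbs a b (derivWithin g (Set.Icc a b)) +
        β₂ * supAbs a b (iteratedDerivWithin 2 g (Set.Icc a b)))) := by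
      gcongr
      · exact hbdd _ (hf.sub hgc)
      · exact hsmooth g hgC.contDiffOn
    _ ≤ γ * (α * (3 / 4 * omega2 a b f h) +
        (β₀ * (supAbs a b f + 3 / 4 * omega2 a b f h) +
        β₁ * ((2 * omega1 a b f h + 3 / 2 * omega2 a b f h) / h) +
        β₂ * (3 / 2 * omega2 a b f h / h ^ 2))) := by
      gcongr
    _ = _ := by ring
end
end
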